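/- arXiv:2411.06887 — 9 statements merged into one kernel-verified Lean document; each statement's English description precedes it below -/
import Mathlib

section
/- Let n, m be positive integers and let P be a real (n+m)×(n+m) matrix. The following are equivalent: (i) there exist an invertible T ∈ ℝ^{n×n}, an invertible K ∈ ℝ^{m×m}, and signature matrices Σ_i ∈ ℝ^{n×n}, Σ_e ∈ ℝ^{m×m} such that, setting L to be the block-diagonal matrix with blocks T and K, and Σ to be the block-diagonal matrix with blocks −Σ_i and Σ_e, one has Σ · L⁻¹ P L = Lᵀ Pᵀ L⁻ᵀ · Σ; (ii) there exists a symmetric invertible matrix Q ∈ ℝ^{(n+m)×(n+m)} satisfying P Q = Q Pᵀ and whose upper-right n×m block Q₁₂ is zero. -/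
open Matrix

/-- Sylvester's law for an invertible real symmetric matrix: it is congruent to a signature
matrix. -/
theorem Matrix.IsSymm.exists_eq_mul_diagonal_sign_mul_transpose {ι : Type*} [Fintype ι]
    [DecidableEq ι] {A : Matrix ι ι ℝ} (hA : A.IsSymm) (hu : IsUnit A) :
    ∃ (T : Matrix ι ι ℝ) (σ : ι → ℝ), IsUnit T ∧ (∀ i, σ i = 1 ∨ σ i = -1) ∧
      T * diagonal σ * Tᵀ = A := by
  have hH : A.IsHermitian := by
    rwa [IsHermitian, conjTranspose_eq_transpose_of_trivial]
  have hdet : A.det ≠ 0 := ((isUnit_iff_isUnit_det A).1 hu).ne_zero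
  have hev : ∀ i, hH.eigenvalues i ≠ 0 := fun i hi =>
    hdet (by
      rw [hH.det_eq_prod_eigenvalues]
      exact Finset.prod_eq_zero (Finset.mem_univ i) (by simp [hi]))
  have hspec : A = (hH.eigenvectorUnitary : Matrix ι ι ℝ) * diagonal hH.eigenvalues *
      (hH.eigenvectorUnitary : Matrix ι ι ℝ)ᵀ := by
    conv_lhs => rw [hH.spectral_theorem, Unitary.conjStarAlgAut_apply]
    rfl
  refine ⟨hH.eigenvectorUnitary * diagonal fun i => √|hH.eigenvalues i|,
    fun i => if 0 < hH.eigenvalues i then 1 else -1, ?_, fun i => ?_, ?_⟩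
  · refine (Unitary.toUnits hH.eigenvectorUnitary).isUnit.mul ?_
    rw [isUnit_diagonal, Pi.isUnit_iff]
    exact fun i => (Real.sqrt_pos.2 (abs_pos.2 (hev i))).ne'.isUnit
  · dsimp only
    split_ifs <;> simp
  · have hdiag : (diagonal fun i => √|hH.eigenvalues i|) *
        (diagonal fun i => if 0 < hH.eigenvalues i then (1 : ℝ) else -1) *
        (diagonal fun i => √|hH.eigenvalues i|) = diagonal hH.eigenvalues := by
      rw [diagonal_mul_diagonal, diagonal_mul_diagonal]
      congr 1
      funext i
      have h := Real.mul_self_sqrt (abs_nonneg (hH.eigenvalues i))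
      split_ifs with hi
      · rw [abs_of_pos hi] at h ⊢
        linarith
      · rw [abs_of_nonpos (not_lt.1 hi)] at h ⊢
        linarith
    conv_rhs => rw [hspec, ← hdiag]
    simp only [transpose_mul, diagonal_transpose, Matrix.mul_assoc]

/-- For an involution `S`, the matrix `S * (L⁻¹ * P * L)` agrees with `Lᵀ * Pᵀ * (L⁻¹)ᵀ * S` iff
`L * S * Lᵀ` intertwines `Pᵀ` and `P`. -/
theorem Matrix.involution_mul_conj_eq_iff {ι R : Type*} [Fintype ι] [DecidableEq ι] [CommRing R]
    {S L : Matrix ι ι R} (P : Matrix ι ι R) (hS : S * S = 1) (hL : IsUnit L) :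
    S * (L⁻¹ * P * L) = Lᵀ * Pᵀ * (L⁻¹)ᵀ * S ↔ P * (L * S * Lᵀ) = L * S * Lᵀ * Pᵀ := by
  have hd : IsUnit L.det := (isUnit_iff_isUnit_det L).1 hL
  have h₁ : L * L⁻¹ = 1 := mul_nonsing_inv L hd
  have h₂ : L⁻¹ * L = 1 := nonsing_inv_mul L hd
  have h₃ : (L⁻¹)ᵀ * Lᵀ = 1 := by rw [← transpose_mul, h₁, transpose_one]
  have h₄ : Lᵀ * (L⁻¹)ᵀ = 1 := by rw [← transpose_mul, h₂, transpose_one]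
  constructor
  · intro h
    calc P * (L * S * Lᵀ) = (L * L⁻¹) * P * (L * S * Lᵀ) := by rw [h₁, Matrix.one_mul]
      _ = L * (S * S) * L⁻¹ * P * (L * S * Lᵀ) := by rw [hS, Matrix.mul_one]
      _ = L * S * (S * (L⁻¹ * P * L)) * S * Lᵀ := by simp only [Matrix.mul_assoc]
      _ = L * S * Lᵀ * Pᵀ * (L⁻¹)ᵀ * (S * S) * Lᵀ := by rw [h]; simp only [Matrix.mul_assoc]
      _ = L * S * Lᵀ * Pᵀ * ((L⁻¹)ᵀ * Lᵀ) := by rw [hS, Matrix.mul_one, Matrix.mul_assoc]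
      _ = L * S * Lᵀ * Pᵀ := by rw [h₃, Matrix.mul_one]
  · intro h
    calc S * (L⁻¹ * P * L) = S * L⁻¹ * P * L * (S * (Lᵀ * (L⁻¹)ᵀ) * S) := by
          rw [h₄, Matrix.mul_one, hS]
          simp only [Matrix.mul_one, Matrix.mul_assoc]
      _ = S * L⁻¹ * (P * (L * S * Lᵀ)) * (L⁻¹)ᵀ * S := by simp only [Matrix.mul_assoc]
      _ = S * (L⁻¹ * L) * S * Lᵀ * Pᵀ * (L⁻¹)ᵀ * S := by rw [h]; simp only [Matrix.mul_assoc]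
      _ = Lᵀ * Pᵀ * (L⁻¹)ᵀ * S := by rw [h₂, Matrix.mul_one, hS, Matrix.one_mul]

theorem Matrix.diagonal_mul_self_of_sign {ι R : Type*} [Fintype ι] [DecidableEq ι] [Ring R]
    {σ : ι → R} (h : ∀ i, σ i = 1 ∨ σ i = -1) : diagonal σ * diagonal σ = 1 := by
  rw [diagonal_mul_diagonal, ← diagonal_one]
  congr 1
  funext i
  rcases h i with hi | hi <;> simp [hi]

theorem Matrix.isUnit_fromBlocks_diagonal_iff {ι κ R : Type*} [Fintype ι] [DecidableEq ι]
    [Fintype κ] [DecidableEq κ] [CommRing R] {A : Matrix ι ι R} {D : Matrix κ κ R} :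
    IsUnit (fromBlocks A 0 0 D) ↔ IsUnit A ∧ IsUnit D := by
  simp only [isUnit_iff_isUnit_det, det_fromBlocks_zero₂₁, IsUnit.mul_iff]

theorem Matrix.fromBlocks_neg_diagonal_mul_self_of_sign {ι κ R : Type*} [Fintype ι]
    [DecidableEq ι] [Fintype κ] [DecidableEq κ] [Ring R] {σ : ι → R} {τ : κ → R}
    (hσ : ∀ i, σ i = 1 ∨ σ i = -1) (hτ : ∀ i, τ i = 1 ∨ τ i = -1) :
    fromBlocks (-diagonal σ) 0 0 (diagonal τ) * fromBlocks (-diagonal σ) 0 0 (diagonal τ) = 1 := by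
  rw [fromBlocks_multiply, neg_mul_neg, diagonal_mul_self_of_sign hσ, diagonal_mul_self_of_sign hτ]
  simp

/-- A system matrix `P` can be transformed by a block-diagonal
change of variables `L = T ⊕ K` into an internally symmetric system with
signature matrix `Σ = (−Σᵢ) ⊕ Σₑ` iff there is a symmetric invertible `Q`
with `P Q = Q Pᵀ` whose upper-right `n × m` block vanishes. -/
theorem symmetrizable_iff_exists_block_diagonal_solution
    (n m : ℕ) (hn : 0 < n) (hm : 0 < m)
    (P : Matrix (Fin n ⊕ Fin m) (Fin n ⊕ Fin m) ℝ) :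
    (∃ (T : Matrix (Fin n) (Fin n) ℝ) (K : Matrix (Fin m) (Fin m) ℝ)
        (σi : Fin n → ℝ) (σe : Fin m → ℝ),
        IsUnit T ∧ IsUnit K ∧
        (∀ i, σi i = 1 ∨ σi i = -1) ∧ (∀ i, σe i = 1 ∨ σe i = -1) ∧
        Matrix.fromBlocks (-Matrix.diagonal σi) 0 0 (Matrix.diagonal σe) *
            ((Matrix.fromBlocks T 0 0 K)⁻¹ * P * Matrix.fromBlocks T 0 0 K) =
          (Matrix.fromBlocks T 0 0 K)ᵀ * Pᵀ * ((Matrix.fromBlocks T 0 0 K)⁻¹)ᵀ *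
            Matrix.fromBlocks (-Matrix.diagonal σi) 0 0 (Matrix.diagonal σe)) ↔
    (∃ Q : Matrix (Fin n ⊕ Fin m) (Fin n ⊕ Fin m) ℝ,
        Q.IsSymm ∧ IsUnit Q ∧ P * Q = Q * Pᵀ ∧ Q.toBlocks₁₂ = 0) := by
  constructor
  · rintro ⟨T, K, σi, σe, hT, hK, hσi, hσe, h⟩
    have hS := fromBlocks_neg_diagonal_mul_self_of_sign hσi hσe
    have hL : IsUnit (fromBlocks T 0 0 K) := isUnit_fromBlocks_diagonal_iff.2 ⟨hT, hK⟩
    refine ⟨_, ?_, ?_, (involution_mul_conj_eq_iff P hS hL).1 h, ?_⟩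
    · simp [IsSymm, transpose_mul, fromBlocks_transpose, Matrix.mul_assoc]
    · exact (hL.mul (IsUnit.of_mul_eq_one _ hS)).mul ((isUnit_transpose _).2 hL)
    · simp only [fromBlocks_transpose, fromBlocks_multiply, toBlocks_fromBlocks₁₂]
      simp
  · rintro ⟨Q, hQ, hu, hPQ, h₁₂⟩
    obtain ⟨A, B, C, D, rfl⟩ : ∃ A B C D, Q = fromBlocks A B C D :=
      ⟨_, _, _, _, (fromBlocks_toBlocks Q).symm⟩
    obtain rfl : B = 0 := by simpa using h₁₂
    obtain ⟨hA, hC, -, hD⟩ := isSymm_fromBlocks_iff.1 hQ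
    obtain rfl : C = 0 := by simpa using hC.symm
    obtain ⟨hAu, hDu⟩ := isUnit_fromBlocks_diagonal_iff.1 hu
    obtain ⟨T, σi, hT, hσi, hTA⟩ := hA.neg.exists_eq_mul_diagonal_sign_mul_transpose hAu.neg
    obtain ⟨K, σe, hK, hσe, hKD⟩ := hD.exists_eq_mul_diagonal_sign_mul_transpose hDu
    have hS := fromBlocks_neg_diagonal_mul_self_of_sign hσi hσe
    have hL : IsUnit (fromBlocks T 0 0 K) := isUnit_fromBlocks_diagonal_iff.2 ⟨hT, hK⟩
    refine ⟨T, K, σi, σe, hT, hK, hσi, hσe, (involution_mul_conj_eq_iff P hS hL).2 ?_⟩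
    have hfac : fromBlocks T 0 0 K * fromBlocks (-diagonal σi) 0 0 (diagonal σe) *
        (fromBlocks T 0 0 K)ᵀ = fromBlocks A 0 0 D := by
      simp only [fromBlocks_transpose, fromBlocks_multiply, Matrix.mul_neg]
      simp [hTA, hKD]
    rwa [hfac]
end

section
/- Let n, m be positive integers and let P be a real (n+m)×(n+m) matrix. The following are equivalent: (i) there exist an invertible T ∈ ℝ^{n×n} and an invertible K ∈ ℝ^{m×m} such that, setting L to be the block-diagonal matrix with blocks T and K, the matrix L⁻¹ P L is symmetric; (ii) there exists a positive definite matrix Q ∈ ℝ^{(n+m)×(n+m)} satisfying P Q = Q Pᵀ and whose upper-right n×m block Q₁₂ is zero. -/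
open Matrix

open scoped MatrixOrder in
theorem Matrix.PosDef.exists_isUnit_mul_transpose_eq {ι : Type*} [Fintype ι] [DecidableEq ι]
    {A : Matrix ι ι ℝ} (hA : A.PosDef) : ∃ T : Matrix ι ι ℝ, IsUnit T ∧ T * Tᵀ = A := by
  obtain ⟨B, hB⟩ := CStarAlgebra.nonneg_iff_eq_star_mul_self.mp hA.posSemidef.nonneg
  rw [star_eq_conjTranspose, conjTranspose_eq_transpose_of_trivial] at hB
  exact ⟨Bᵀ, isUnit_of_mul_isUnit_left (hB ▸ hA.isUnit), by rw [transpose_transpose, ← hB]⟩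

theorem Matrix.isSymm_inv_mul_mul_iff {ι R : Type*} [Fintype ι] [DecidableEq ι] [CommRing R]
    {L : Matrix ι ι R} (hL : IsUnit L) (P : Matrix ι ι R) :
    (L⁻¹ * P * L).IsSymm ↔ P * (L * Lᵀ) = L * Lᵀ * Pᵀ := by
  have hLdet : IsUnit L.det := (isUnit_iff_isUnit_det L).mp hL
  have hLtdet : IsUnit Lᵀ.det := by rwa [det_transpose]
  have hl : L * (L⁻¹ * P * L) * Lᵀ = P * (L * Lᵀ) := by
    simp only [Matrix.mul_assoc, mul_nonsing_inv_cancel_left _ _ hLdet]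
  have hr : L * (L⁻¹ * P * L)ᵀ * Lᵀ = L * Lᵀ * Pᵀ := by
    simp only [transpose_mul, transpose_nonsing_inv, Matrix.mul_assoc,
      nonsing_inv_mul _ hLtdet, Matrix.mul_one]
  rw [← hl, ← hr, ((isUnit_iff_isUnit_det Lᵀ).mpr hLtdet).mul_left_inj,
    hL.mul_right_inj, eq_comm, IsSymm]

/-- Complete symmetrizability: `P` can be transformed by a
block-diagonal change of variables `L = T ⊕ K` into a symmetric matrix
iff there is a positive definite `Q` with `P Q = Q Pᵀ` whose upper-right
`n × m` block vanishes. -/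
theorem completely_symmetrizable_iff_exists_posdef_solution
    (n m : ℕ) (hn : 0 < n) (hm : 0 < m)
    (P : Matrix (Fin n ⊕ Fin m) (Fin n ⊕ Fin m) ℝ) :
    (∃ (T : Matrix (Fin n) (Fin n) ℝ) (K : Matrix (Fin m) (Fin m) ℝ),
        IsUnit T ∧ IsUnit K ∧
        ((Matrix.fromBlocks T 0 0 K)⁻¹ * P * Matrix.fromBlocks T 0 0 K).IsSymm) ↔
    (∃ Q : Matrix (Fin n ⊕ Fin m) (Fin n ⊕ Fin m) ℝ,
        Q.PosDef ∧ P * Q = Q * Pᵀ ∧ Q.toBlocks₁₂ = 0) := by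
  constructor
  · rintro ⟨T, K, hT, hK, h⟩
    have hL : IsUnit (fromBlocks T 0 0 K) := isUnit_fromBlocks_zero₂₁.mpr ⟨hT, hK⟩
    refine ⟨fromBlocks T 0 0 K * (fromBlocks T 0 0 K)ᵀ, ?_,
      (isSymm_inv_mul_mul_iff hL P).mp h, ?_⟩
    · simpa only [conjTranspose_eq_transpose_of_trivial] using
        PosDef.mul_conjTranspose_self _ (vecMul_injective_of_isUnit hL)
    · simp [fromBlocks_transpose, fromBlocks_multiply]
  · rintro ⟨Q, hQ, hPQ, h₁₂⟩
    have hsymm : Qᵀ = Q := by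
      simpa only [conjTranspose_eq_transpose_of_trivial] using hQ.isHermitian.eq
    have h₂₁ : Q.toBlocks₂₁ = 0 := by
      ext i j
      exact (congrFun₂ hsymm (.inr i) (.inl j)).symm.trans (congrFun₂ h₁₂ j i)
    obtain ⟨T, hT, hTQ⟩ :=
      (show Q.toBlocks₁₁.PosDef from hQ.submatrix Sum.inl_injective).exists_isUnit_mul_transpose_eq
    obtain ⟨K, hK, hKQ⟩ :=
      (show Q.toBlocks₂₂.PosDef from hQ.submatrix Sum.inr_injective).exists_isUnit_mul_transpose_eq
    refine ⟨T, K, hT, hK,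
      (isSymm_inv_mul_mul_iff (isUnit_fromBlocks_zero₂₁.mpr ⟨hT, hK⟩) P).mpr ?_⟩
    have hLQ : fromBlocks T 0 0 K * (fromBlocks T 0 0 K)ᵀ = Q := by
      rw [← fromBlocks_toBlocks Q, h₁₂, h₂₁, ← hTQ, ← hKQ]
      simp [fromBlocks_transpose, fromBlocks_multiply]
    rw [hLQ, hPQ]
end

section
/- Every real q×q matrix P can be written as a product P = Q N where Q and N are real symmetric q×q matrices and Q is invertible. -/
open Matrix

open Polynomial in
/-- For a nonzero ideal `I`, the quotient `K[X] ⧸ I` is a Frobenius algebra: it has a linear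
functional whose kernel contains no nonzero ideal. -/
theorem Polynomial.exists_functional_quotient_nondegenerate {K : Type*} [Field K] {I : Ideal K[X]}
    (hI : I ≠ ⊥) :
    ∃ φ : (K[X] ⧸ I) →ₗ[K] K, ∀ x, (∀ y, φ (x * y) = 0) → x = 0 := by
  obtain ⟨g, hg, rfl⟩ : ∃ g : K[X], g.Monic ∧ I = Ideal.span {g} := by
    obtain ⟨p, rfl⟩ := (IsPrincipalIdealRing.principal I).principal
    have hp : p ≠ 0 := by
      rintro rfl
      simp at hI
    refine ⟨p * C p.leadingCoeff⁻¹, monic_mul_leadingCoeff_inv hp, ?_⟩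
    exact (Ideal.span_singleton_mul_right_unit
      (isUnit_C.2 (inv_ne_zero (leadingCoeff_ne_zero.2 hp)).isUnit) p).symm
  let φ : AdjoinRoot g →ₗ[K] K :=
    (lcoeff K (g.natDegree - 1)).comp (AdjoinRoot.modByMonicHom hg)
  suffices h : ∀ x : AdjoinRoot g, (∀ y, φ (x * y) = 0) → x = 0 from ⟨φ, h⟩
  intro x hx
  by_contra hx0
  obtain ⟨f, rfl⟩ := AdjoinRoot.mk_surjective x
  set r := f %ₘ g
  have hfr : AdjoinRoot.mk g f = AdjoinRoot.mk g r := by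
    simpa using (AdjoinRoot.mk_leftInverse hg (AdjoinRoot.mk g f)).symm
  rw [hfr] at hx hx0
  have hr0 : r ≠ 0 := fun h => hx0 (by rw [h, map_zero])
  have hdeg : r.natDegree < g.natDegree :=
    natDegree_lt_natDegree hr0 (degree_modByMonic_lt f hg)
  have key := hx (AdjoinRoot.mk g (X ^ (g.natDegree - 1 - r.natDegree)))
  rw [← map_mul] at key
  have hlt : (r * X ^ (g.natDegree - 1 - r.natDegree)).degree < g.degree := by
    apply degree_lt_degree
    rw [natDegree_mul_X_pow _ hr0]
    omega
  simp only [φ, LinearMap.comp_apply, AdjoinRoot.modByMonicHom_mk,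
    (modByMonic_eq_self_iff hg).2 hlt, lcoeff_apply] at key
  rw [show g.natDegree - 1 = r.natDegree + (g.natDegree - 1 - r.natDegree) by omega,
    Nat.add_sub_cancel_left, coeff_mul_X_pow] at key
  exact hr0 (leadingCoeff_eq_zero.1 key)

open Polynomial in
/-- Every endomorphism of a finite-dimensional vector space is self-adjoint for some
nondegenerate symmetric bilinear form. -/
theorem LinearMap.exists_isSymm_separatingLeft_isAdjointPair {K V : Type*} [Field K]
    [AddCommGroup V] [Module K V] [FiniteDimensional K V] (T : V →ₗ[K] V) :
    ∃ B : V →ₗ[K] V →ₗ[K] K, (∀ x y, B x y = B y x) ∧ B.SeparatingLeft ∧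
      B.IsAdjointPair B T T := by
  classical
  obtain ⟨ι, _, p, hp, e, ⟨E⟩⟩ := Module.equiv_directSum_of_isTorsion
    (Module.AEval.isTorsion_of_finiteDimensional K V T)
  choose φ hφ using fun i => exists_functional_quotient_nondegenerate
    (I := Ideal.span {p i ^ e i}) (by simpa using pow_ne_zero _ (hp i).ne_zero)
  let F := E.trans (DirectSum.linearEquivFunOnFintype K[X] ι fun i =>
    K[X] ⧸ Ideal.span {p i ^ e i})
  let c : ∀ i, V →ₗ[K] K[X] ⧸ Ideal.span {p i ^ e i} := fun i =>
    ((LinearMap.proj i).comp F.toLinearMap).restrictScalars K ∘ₗ (Module.AEval'.of T).toLinearMap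
  have hc : ∀ i x, c i x = F (Module.AEval'.of T x) i := fun _ _ => rfl
  have hcT : ∀ i x, c i (T x) = Ideal.Quotient.mk _ X * c i x := by
    intro i x
    rw [hc, hc, ← Module.AEval'.X_smul_of, map_smul]
    rfl
  let B : V →ₗ[K] V →ₗ[K] K := ∑ i, ((LinearMap.mul K _).compr₂ (φ i)).compl₁₂ (c i) (c i)
  have hB : ∀ x y, B x y = ∑ i, φ i (c i x * c i y) := fun x y => by simp [B]
  refine ⟨B, fun x y => by simp only [hB, mul_comm], fun x hx => ?_, fun x y => ?_⟩
  · suffices h : F (Module.AEval'.of T x) = 0 by simpa using h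
    funext i
    refine hφ i _ fun y => ?_
    have h := hx ((Module.AEval'.of T).symm (F.symm (Pi.single i y)))
    rw [hB, Finset.sum_eq_single i] at h
    · simpa [hc] using h
    · intro j _ hj
      simp [hc, hj]
    · simp
  · simp only [hB, hcT]
    exact Finset.sum_congr rfl fun i _ => by congr 1; ring

/-- Symmetric decomposition (Frobenius/Taussky): every real square
matrix is the product of two real symmetric matrices, the left one invertible. -/
theorem symmetric_decomposition
    (q : ℕ) (P : Matrix (Fin q) (Fin q) ℝ) :
    ∃ Q N : Matrix (Fin q) (Fin q) ℝ,
      Q.IsSymm ∧ N.IsSymm ∧ IsUnit Q ∧ P = Q * N := by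
  obtain ⟨B, hsymm, hsep, hadj⟩ :=
    (Matrix.toLin' P).exists_isSymm_separatingLeft_isAdjointPair
  set G := LinearMap.toMatrix₂' ℝ B with hG
  have hGs : Gᵀ = G := by
    ext i j
    simp [hG, LinearMap.toMatrix₂'_apply, hsymm (Pi.single j 1)]
  have hdet : IsUnit G.det :=
    (Matrix.separatingLeft_iff_det_ne_zero.1 hsep.toMatrix₂').isUnit
  have hPG : Pᵀ * G = G * P := by
    rw [← Matrix.toLinearMap₂'_toMatrix' (R := ℝ) B] at hadj
    exact (isAdjointPair_toLinearMap₂' G G P P).1 hadj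
  refine ⟨G⁻¹, G * P, ?_, ?_, ?_, ?_⟩
  · rw [Matrix.IsSymm, Matrix.transpose_nonsing_inv, hGs]
  · rw [Matrix.IsSymm, Matrix.transpose_mul, hGs, hPG]
  · exact (Matrix.isUnit_nonsing_inv_iff).2 ((Matrix.isUnit_iff_isUnit_det G).2 hdet)
  · rw [Matrix.nonsing_inv_mul_cancel_left _ _ hdet]
end

section
/- Let P be a real q×q matrix, V an invertible real q×q matrix, and J a real diagonal q×q matrix with pairwise distinct diagonal entries, such that P V = V J. Then a real q×q matrix Q satisfies P Q = Q Pᵀ if and only if Q = V X Vᵀ for some real diagonal matrix X. In particular, every solution Q of P Q = Q Pᵀ is symmetric, and Q is invertible if and only if all diagonal entries of X are nonzero. -/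
open Matrix

/-- A matrix commuting with a diagonal matrix with distinct entries is diagonal. -/
theorem Matrix.eq_diagonal_diag_of_commute_diagonal {n R : Type*} [Fintype n] [DecidableEq n]
    [CommRing R] [NoZeroDivisors R] {d : n → R} (hd : Function.Injective d) {Y : Matrix n n R}
    (h : diagonal d * Y = Y * diagonal d) : Y = diagonal Y.diag := by
  ext i j
  by_cases hij : i = j
  · subst hij
    simp
  · have h' := congrFun (congrFun h i) j
    rw [diagonal_mul, mul_diagonal] at h'
    have h0 : (d i - d j) * Y i j = 0 := by linear_combination h'
    rw [diagonal_apply_ne _ hij]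
    exact (mul_eq_zero.mp h0).resolve_left (sub_ne_zero.mpr (hd.ne hij))

/-- If `P` is diagonalized by `V` with distinct eigenvalues, the solutions of `P Q = Q Pᵀ` are
the matrices `V X Vᵀ` with `X` diagonal. -/
theorem Matrix.mul_eq_mul_transpose_iff_exists_diagonal {n R : Type*} [Fintype n] [DecidableEq n]
    [CommRing R] [NoZeroDivisors R] {P V : Matrix n n R} {d : n → R} (hV : IsUnit V)
    (hd : Function.Injective d) (hPV : P * V = V * diagonal d) (Q : Matrix n n R) :
    P * Q = Q * Pᵀ ↔ ∃ x : n → R, Q = V * diagonal x * Vᵀ := by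
  have hPV' : Vᵀ * Pᵀ = diagonal d * Vᵀ := by
    simpa using congrArg transpose hPV
  constructor
  · intro h
    obtain ⟨W, hVW, hWV⟩ := isUnit_iff_exists.mp hV
    have hWP : W * P = diagonal d * W := by
      calc W * P = W * (P * V) * W := by rw [Matrix.mul_assoc, Matrix.mul_assoc, hVW, mul_one]
        _ = diagonal d * W := by rw [hPV, ← Matrix.mul_assoc, hWV, one_mul]
    have hWP' : Pᵀ * Wᵀ = Wᵀ * diagonal d := by
      simpa using congrArg transpose hWP
    have hWV' : Wᵀ * Vᵀ = 1 := by
      rw [← transpose_mul, hVW, transpose_one]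
    have hY : diagonal d * (W * Q * Wᵀ) = W * Q * Wᵀ * diagonal d := by
      calc diagonal d * (W * Q * Wᵀ) = diagonal d * W * Q * Wᵀ := by simp only [Matrix.mul_assoc]
        _ = W * (P * Q) * Wᵀ := by rw [← hWP]; simp only [Matrix.mul_assoc]
        _ = W * Q * (Pᵀ * Wᵀ) := by rw [h]; simp only [Matrix.mul_assoc]
        _ = W * Q * Wᵀ * diagonal d := by rw [hWP']; simp only [Matrix.mul_assoc]
    refine ⟨(W * Q * Wᵀ).diag, ?_⟩
    rw [← eq_diagonal_diag_of_commute_diagonal hd hY]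
    calc Q = V * W * Q * (Wᵀ * Vᵀ) := by rw [hVW, hWV', one_mul, mul_one]
      _ = V * (W * Q * Wᵀ) * Vᵀ := by simp only [Matrix.mul_assoc]
  · rintro ⟨x, rfl⟩
    calc P * (V * diagonal x * Vᵀ) = P * V * diagonal x * Vᵀ := by simp only [Matrix.mul_assoc]
      _ = V * (diagonal d * diagonal x) * Vᵀ := by rw [hPV]; simp only [Matrix.mul_assoc]
      _ = V * (diagonal x * diagonal d) * Vᵀ := by rw [(commute_diagonal d x).eq]
      _ = V * diagonal x * (Vᵀ * Pᵀ) := by rw [hPV']; simp only [Matrix.mul_assoc]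
      _ = V * diagonal x * Vᵀ * Pᵀ := by simp only [Matrix.mul_assoc]

/-- If `P V = V J` with `V` invertible and `J` diagonal with
pairwise distinct diagonal entries, then `Q` solves `P Q = Q Pᵀ` iff
`Q = V X Vᵀ` for some diagonal `X`; every solution is symmetric, and a solution
`Q = V X Vᵀ` is invertible iff all diagonal entries of `X` are nonzero. -/
theorem solutions_for_distinct_real_eigenvalues
    (q : ℕ) (P V : Matrix (Fin q) (Fin q) ℝ) (d : Fin q → ℝ)
    (hV : IsUnit V) (hd : Function.Injective d)
    (hPV : P * V = V * Matrix.diagonal d) :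
    ∀ Q : Matrix (Fin q) (Fin q) ℝ,
      (P * Q = Q * Pᵀ ↔ ∃ x : Fin q → ℝ, Q = V * Matrix.diagonal x * Vᵀ) ∧
      (P * Q = Q * Pᵀ → Q.IsSymm) ∧
      (∀ x : Fin q → ℝ, Q = V * Matrix.diagonal x * Vᵀ →
        (IsUnit Q ↔ ∀ j, x j ≠ 0)) := by
  intro Q
  have hiff := mul_eq_mul_transpose_iff_exists_diagonal hV hd hPV Q
  refine ⟨hiff, fun h => ?_, ?_⟩
  · obtain ⟨x, rfl⟩ := hiff.mp h
    simp [Matrix.IsSymm, Matrix.mul_assoc]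
  · rintro x rfl
    have hdet : V.det ≠ 0 := ((isUnit_iff_isUnit_det V).mp hV).ne_zero
    simp [isUnit_iff_isUnit_det, hdet, Finset.prod_eq_zero_iff]
end

section
/- Let n, m be positive integers, let P be a real (n+m)×(n+m) matrix, V an invertible real (n+m)×(n+m) matrix, and J a real diagonal matrix with n+m pairwise distinct diagonal entries, such that P V = V J. Write W for the matrix of the first n rows of V and Z for the matrix of the last m rows of V, and let w_j ∈ ℝⁿ and z_j ∈ ℝᵐ denote the j-th columns of W and Z. Then there exists a symmetric invertible Q ∈ ℝ^{(n+m)×(n+m)} with P Q = Q Pᵀ and whose upper-right n×m block is zero, if and only if there exists x ∈ ℝ^{n+m} with all entries x_j nonzero such that the n×m matrix ∑_{j=1}^{n+m} x_j · w_j z_jᵀ is zero. -/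
open Matrix

namespace Matrix

/-- A matrix commuting with a diagonal matrix with distinct entries is diagonal. -/
theorem eq_diagonal_of_diagonal_mul_eq {ι R : Type*} [Fintype ι] [DecidableEq ι] [CommRing R]
    [IsDomain R] {d : ι → R} (hd : Function.Injective d) {D : Matrix ι ι R}
    (h : diagonal d * D = D * diagonal d) : D = diagonal fun i => D i i := by
  ext i j
  rcases eq_or_ne i j with rfl | hij
  · simp
  · have hentry := congrFun (congrFun h i) j
    rw [diagonal_mul, mul_diagonal] at hentry
    have hprod : (d i - d j) * D i j = 0 := by linear_combination hentry
    rw [diagonal_apply_ne _ hij]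
    exact (mul_eq_zero.mp hprod).resolve_left (sub_ne_zero.mpr (hd.ne hij))

/-- The upper-right block of `V * diagonal x * Vᵀ` is a weighted sum of outer products of
columns. -/
theorem toBlocks₁₂_mul_diagonal_mul_transpose {α β ι R : Type*} [Fintype ι] [DecidableEq ι]
    [CommRing R] (V : Matrix (α ⊕ β) ι R) (x : ι → R) :
    (V * diagonal x * Vᵀ).toBlocks₁₂ =
      ∑ j, x j • vecMulVec (fun i => V (Sum.inl i) j) (fun i => V (Sum.inr i) j) := by
  ext a b
  simp only [toBlocks₁₂, of_apply, mul_apply (M := V * diagonal x), mul_diagonal, transpose_apply,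
    sum_apply, smul_apply, vecMulVec_apply, smul_eq_mul]
  exact Finset.sum_congr rfl fun j _ => by ring

/-- If `V` diagonalizes `P` with distinct eigenvalues, every solution `Q` of `P * Q = Q * Pᵀ`
has the form `V * diagonal x * Vᵀ`. -/
theorem exists_eq_mul_diagonal_mul_transpose {ι R : Type*} [Fintype ι] [DecidableEq ι]
    [CommRing R] [IsDomain R] {P V Q : Matrix ι ι R} {d : ι → R} (hV : IsUnit V)
    (hd : Function.Injective d) (hPV : P * V = V * diagonal d) (hQ : P * Q = Q * Pᵀ) :
    ∃ x : ι → R, Q = V * diagonal x * Vᵀ := by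
  obtain ⟨U, hVU, hUV⟩ := isUnit_iff_exists.mp hV
  have hUP : U * P = diagonal d * U := by
    calc U * P = U * (P * V) * U := by simp only [Matrix.mul_assoc, hVU, Matrix.mul_one]
      _ = diagonal d * U := by rw [hPV, ← Matrix.mul_assoc, hUV, Matrix.one_mul]
  have hPU : Pᵀ * Uᵀ = Uᵀ * diagonal d := by
    rw [← transpose_mul, hUP, transpose_mul, diagonal_transpose]
  have hcomm : diagonal d * (U * Q * Uᵀ) = (U * Q * Uᵀ) * diagonal d := by
    calc diagonal d * (U * Q * Uᵀ) = (diagonal d * U) * Q * Uᵀ := by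
          simp only [Matrix.mul_assoc]
      _ = U * (P * Q) * Uᵀ := by rw [← hUP]; simp only [Matrix.mul_assoc]
      _ = U * Q * (Pᵀ * Uᵀ) := by rw [hQ]; simp only [Matrix.mul_assoc]
      _ = (U * Q * Uᵀ) * diagonal d := by rw [hPU]; simp only [Matrix.mul_assoc]
  refine ⟨fun i => (U * Q * Uᵀ) i i, ?_⟩
  rw [← eq_diagonal_of_diagonal_mul_eq hd hcomm]
  have hUV' : Uᵀ * Vᵀ = 1 := by rw [← transpose_mul, hVU, transpose_one]
  calc Q = (V * U) * Q * (Uᵀ * Vᵀ) := by rw [hVU, hUV', Matrix.one_mul, Matrix.mul_one]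
    _ = V * (U * Q * Uᵀ) * Vᵀ := by simp only [Matrix.mul_assoc]

/-- If `V` diagonalizes `P`, then `Q = V * diagonal x * Vᵀ` solves `P * Q = Q * Pᵀ`. -/
theorem mul_mul_diagonal_mul_transpose_eq {ι R : Type*} [Fintype ι] [DecidableEq ι]
    [CommRing R] {P V : Matrix ι ι R} {d : ι → R} (hPV : P * V = V * diagonal d) (x : ι → R) :
    P * (V * diagonal x * Vᵀ) = V * diagonal x * Vᵀ * Pᵀ := by
  have hVP : Vᵀ * Pᵀ = diagonal d * Vᵀ := by
    rw [← transpose_mul, hPV, transpose_mul, diagonal_transpose]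
  calc P * (V * diagonal x * Vᵀ) = (P * V) * diagonal x * Vᵀ := by simp only [Matrix.mul_assoc]
    _ = V * (diagonal d * diagonal x) * Vᵀ := by rw [hPV]; simp only [Matrix.mul_assoc]
    _ = V * (diagonal x * diagonal d) * Vᵀ := by rw [(commute_diagonal d x).eq]
    _ = V * diagonal x * (Vᵀ * Pᵀ) := by rw [hVP]; simp only [Matrix.mul_assoc]
    _ = V * diagonal x * Vᵀ * Pᵀ := by simp only [Matrix.mul_assoc]

theorem isUnit_mul_diagonal_mul_transpose_iff {ι K : Type*} [Fintype ι] [DecidableEq ι] [Field K]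
    {V : Matrix ι ι K} (hV : IsUnit V) (x : ι → K) :
    IsUnit (V * diagonal x * Vᵀ) ↔ ∀ i, x i ≠ 0 := by
  have hdet : V.det ≠ 0 := ((isUnit_iff_isUnit_det V).mp hV).ne_zero
  simp [isUnit_iff_isUnit_det, hdet, Finset.prod_ne_zero_iff]

end Matrix

/-- (Corollary 1) For a system matrix `P` with distinct real
eigenvalues (`P V = V J`, `V` invertible, `J` diagonal with pairwise distinct
entries), a symmetric invertible solution `Q` of `P Q = Q Pᵀ` with zero
upper-right block exists iff some vector `x` with all entries nonzero satisfies
`∑ j, x j • w_j z_jᵀ = 0`, where `w_j`, `z_j` are the columns of the first `n`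
rows and of the last `m` rows of `V`, respectively. -/
theorem symmetrizable_iff_kernel_vector_with_nonzero_entries
    (n m : ℕ) (hn : 0 < n) (hm : 0 < m)
    (P V : Matrix (Fin n ⊕ Fin m) (Fin n ⊕ Fin m) ℝ) (d : Fin n ⊕ Fin m → ℝ)
    (hV : IsUnit V) (hd : Function.Injective d)
    (hPV : P * V = V * Matrix.diagonal d) :
    (∃ Q : Matrix (Fin n ⊕ Fin m) (Fin n ⊕ Fin m) ℝ,
        Q.IsSymm ∧ IsUnit Q ∧ P * Q = Q * Pᵀ ∧ Q.toBlocks₁₂ = 0) ↔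
    (∃ x : Fin n ⊕ Fin m → ℝ, (∀ j, x j ≠ 0) ∧
        ∑ j : Fin n ⊕ Fin m,
          x j • Matrix.vecMulVec (fun i : Fin n => V (Sum.inl i) j)
            (fun i : Fin m => V (Sum.inr i) j) = 0) := by
  constructor
  · rintro ⟨Q, -, hQ, hPQ, hQ₁₂⟩
    obtain ⟨x, rfl⟩ := exists_eq_mul_diagonal_mul_transpose hV hd hPV hPQ
    exact ⟨x, (isUnit_mul_diagonal_mul_transpose_iff hV x).mp hQ,
      (toBlocks₁₂_mul_diagonal_mul_transpose V x).symm.trans hQ₁₂⟩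
  · rintro ⟨x, hx, hsum⟩
    refine ⟨V * diagonal x * Vᵀ, ?_, (isUnit_mul_diagonal_mul_transpose_iff hV x).mpr hx,
      mul_mul_diagonal_mul_transpose_eq hPV x,
      (toBlocks₁₂_mul_diagonal_mul_transpose V x).trans hsum⟩
    simp [IsSymm, transpose_mul, Matrix.mul_assoc]
end

section
/- Let n, m be positive integers, let P be a real (n+m)×(n+m) matrix, V an invertible real (n+m)×(n+m) matrix, and J a real diagonal matrix with n+m pairwise distinct diagonal entries, such that P V = V J. Write W for the matrix of the first n rows of V and Z for the matrix of the last m rows of V, with columns w_j and z_j. Suppose x ∈ ℝ^{n+m} has all entries nonzero and ∑_{j=1}^{n+m} x_j · w_j z_jᵀ = 0. Then Q := V · diag(x) · Vᵀ is symmetric and invertible, satisfies P Q = Q Pᵀ with zero upper-right n×m block, and the number of positive eigenvalues of Q minus the number of negative eigenvalues of Q (counted with multiplicity) equals ∑_{j=1}^{n+m} sgn(x_j). -/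
open Matrix

/-- A matrix congruent to a diagonal matrix `D` represents a quadratic form equivalent to the
weighted sum of squares whose weights are the entries of `D`. -/
lemma Matrix.equivalent_weightedSumSquares_of_isUnit {ι : Type*} [Fintype ι] [DecidableEq ι]
    {V : Matrix ι ι ℝ} (hV : IsUnit V) (x : ι → ℝ) :
    (V * diagonal x * Vᵀ).toQuadraticForm'.Equivalent (QuadraticMap.weightedSumSquares ℝ x) := by
  have hVt : IsUnit Vᵀ := by simpa using hV
  let e : (ι → ℝ) ≃ₗ[ℝ] (ι → ℝ) := Vᵀ.toLinearEquiv' hVt.invertible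
  refine ⟨⟨e, fun y => ?_⟩⟩
  have he : e y = Vᵀ *ᵥ y := rfl
  change QuadraticMap.weightedSumSquares ℝ x (e y) = _
  rw [he, QuadraticMap.weightedSumSquares_apply, toQuadraticForm',
    LinearMap.BilinMap.toQuadraticMap_apply, toLinearMap₂'_apply', ← mulVec_mulVec, ← mulVec_mulVec, dotProduct_mulVec, ← mulVec_transpose]
  simp only [dotProduct, mulVec_diagonal, smul_eq_mul]
  exact Finset.sum_congr rfl fun i _ => by ring

open Classical in
lemma Real.sum_sign_eq_ncard_sub_ncard {ι : Type*} [Fintype ι] (x : ι → ℝ) :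
    ∑ j, Real.sign (x j) = ({j | 0 < x j}.ncard : ℝ) - ({j | x j < 0}.ncard : ℝ) := by
  have h : ∀ j, Real.sign (x j) = (if 0 < x j then 1 else 0) - (if x j < 0 then 1 else 0) := by
    intro j
    unfold Real.sign
    split_ifs <;> linarith
  simp [h, Finset.sum_sub_distrib, Set.ncard_eq_toFinset_card']

/-- The signature of a matrix congruent to a diagonal matrix is the sum of the signs of the
diagonal entries. -/
lemma Matrix.card_eigenvalues_pos_sub_card_eigenvalues_neg
    {ι : Type*} [Fintype ι] [DecidableEq ι] {V : Matrix ι ι ℝ} (hV : IsUnit V) (x : ι → ℝ)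
    (hQ : (V * diagonal x * Vᵀ).IsHermitian) :
    (Nat.card {i : ι // 0 < hQ.eigenvalues i} : ℝ) -
      (Nat.card {i : ι // hQ.eigenvalues i < 0} : ℝ) = ∑ j, Real.sign (x j) := by
  have hU : IsUnit (hQ.eigenvectorUnitary : Matrix ι ι ℝ) := Unitary.isUnit_coe
  have hspec : V * diagonal x * Vᵀ = (hQ.eigenvectorUnitary : Matrix ι ι ℝ) *
      diagonal hQ.eigenvalues * (hQ.eigenvectorUnitary : Matrix ι ι ℝ)ᵀ := by
    conv_lhs => rw [hQ.spectral_theorem, Unitary.conjStarAlgAut_apply, star_eq_conjTranspose,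
      conjTranspose_eq_transpose_of_trivial]
    rfl
  have hx := equivalent_weightedSumSquares_of_isUnit hV x
  have hl := equivalent_weightedSumSquares_of_isUnit hU hQ.eigenvalues
  rw [← hspec] at hl
  have hpos := (QuadraticForm.sigPos_of_equiv_weightedSumSquares hl).symm.trans
    (QuadraticForm.sigPos_of_equiv_weightedSumSquares hx)
  have hneg := (QuadraticForm.sigNeg_of_equiv_weightedSumSquares hl).symm.trans
    (QuadraticForm.sigNeg_of_equiv_weightedSumSquares hx)
  rw [Real.sum_sign_eq_ncard_sub_ncard, ← hpos, ← hneg]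
  rfl

/-- (Signature formula of Corollary 1) If `P V = V J` with `V`
invertible and `J` diagonal with pairwise distinct entries, and `x` has all
entries nonzero with `∑ j, x j • w_j z_jᵀ = 0`, then `Q := V diag(x) Vᵀ` is
symmetric, invertible, solves `P Q = Q Pᵀ` with zero upper-right block, and the
number of positive minus negative eigenvalues of `Q` equals `∑ j, sgn(x j)`. -/
theorem signature_of_symmetrized_system
    (n m : ℕ) (hn : 0 < n) (hm : 0 < m)
    (P V : Matrix (Fin n ⊕ Fin m) (Fin n ⊕ Fin m) ℝ) (d : Fin n ⊕ Fin m → ℝ)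
    (hV : IsUnit V) (hd : Function.Injective d)
    (hPV : P * V = V * Matrix.diagonal d)
    (x : Fin n ⊕ Fin m → ℝ) (hx : ∀ j, x j ≠ 0)
    (hker : ∑ j : Fin n ⊕ Fin m,
        x j • Matrix.vecMulVec (fun i : Fin n => V (Sum.inl i) j)
          (fun i : Fin m => V (Sum.inr i) j) = 0) :
    (V * Matrix.diagonal x * Vᵀ).IsSymm ∧
    IsUnit (V * Matrix.diagonal x * Vᵀ) ∧
    P * (V * Matrix.diagonal x * Vᵀ) = (V * Matrix.diagonal x * Vᵀ) * Pᵀ ∧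
    (V * Matrix.diagonal x * Vᵀ).toBlocks₁₂ = 0 ∧
    ∃ hQ : (V * Matrix.diagonal x * Vᵀ).IsHermitian,
      (Nat.card {i : Fin n ⊕ Fin m // 0 < hQ.eigenvalues i} : ℝ) -
        (Nat.card {i : Fin n ⊕ Fin m // hQ.eigenvalues i < 0} : ℝ) =
        ∑ j : Fin n ⊕ Fin m, Real.sign (x j) := by
  have hsymm : (V * diagonal x * Vᵀ).IsSymm := by
    simp [IsSymm, transpose_mul, Matrix.mul_assoc]
  have hVt : IsUnit Vᵀ := by simpa using hV
  have hdx : IsUnit (diagonal x) :=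
    isUnit_diagonal.mpr (Pi.isUnit_iff.mpr fun j => (hx j).isUnit)
  refine ⟨hsymm, (hV.mul hdx).mul hVt, ?_, ?_, ?_⟩
  · have hPVt : Vᵀ * Pᵀ = diagonal d * Vᵀ := by
      rw [← transpose_mul, hPV, transpose_mul, diagonal_transpose]
    have hcomm : diagonal d * diagonal x = diagonal x * diagonal d := by
      simp only [diagonal_mul_diagonal, mul_comm]
    rw [Matrix.mul_assoc _ Vᵀ, hPVt, ← Matrix.mul_assoc, ← Matrix.mul_assoc, hPV,
      ← Matrix.mul_assoc, Matrix.mul_assoc V, hcomm, ← Matrix.mul_assoc]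
  · rw [← hker]
    ext i j
    rw [toBlocks₁₂, of_apply, mul_apply, Matrix.sum_apply]
    simp only [mul_diagonal, transpose_apply, Matrix.smul_apply, vecMulVec_apply, smul_eq_mul]
    exact Finset.sum_congr rfl fun k _ => by ring
  · have hQ : (V * diagonal x * Vᵀ).IsHermitian := by
      rwa [IsHermitian, conjTranspose_eq_transpose_of_trivial]
    exact ⟨hQ, card_eigenvalues_pos_sub_card_eigenvalues_neg hV x hQ⟩
end

section
/- Let r be a positive integer and t₁,…,t_r positive integers with N = t₁ + ⋯ + t_r. Let W be a real n×N matrix and Z a real m×N matrix, partitioned column-wise into blocks W_j ∈ ℝ^{n×t_j} and Z_j ∈ ℝ^{m×t_j}. Suppose there exists an invertible block-diagonal real N×N matrix X = X₁ ⊕ X₂ ⊕ ⋯ ⊕ X_r (with X_j of size t_j×t_j) such that W X Zᵀ = 0. Then the rank of the Khatri-Rao product Z ⋆ W = [Z₁⊗W₁ Z₂⊗W₂ … Z_r⊗W_r] is strictly less than t₁² + t₂² + ⋯ + t_r². -/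
open Matrix

theorem Matrix.rank_lt_card_of_mulVec_eq_zero {m n K : Type*} [Fintype m] [Fintype n] [Field K]
    (M : Matrix m n K) {v : n → K} (hv : v ≠ 0) (hMv : M *ᵥ v = 0) :
    M.rank < Fintype.card n := by
  have hker : 0 < Module.finrank K (LinearMap.ker M.mulVecLin) := by
    have : Nontrivial (LinearMap.ker M.mulVecLin) :=
      ⟨⟨v, by simpa using hMv⟩, 0, fun h => hv (congrArg Subtype.val h)⟩
    exact Module.finrank_pos
  have hsum := M.mulVecLin.finrank_range_add_finrank_ker
  rw [Module.finrank_fintype_fun_eq_card] at hsum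
  rw [Matrix.rank]
  omega

theorem Matrix.mul_blockDiagonal'_apply {l o R : Type*} {m' n' : o → Type*} [Fintype o]
    [DecidableEq o] [∀ j, Fintype (m' j)] [NonUnitalNonAssocSemiring R]
    (A : Matrix l ((j : o) × m' j) R) (B : (j : o) → Matrix (m' j) (n' j) R)
    (i : l) (j : o) (b : n' j) :
    (A * Matrix.blockDiagonal' B) i ⟨j, b⟩ = ∑ a, A i ⟨j, a⟩ * B j a b := by
  rw [Matrix.mul_apply, Fintype.sum_sigma, Finset.sum_eq_single j]
  · simp only [Matrix.blockDiagonal'_apply_eq]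
  · intro k _ hk
    exact Finset.sum_eq_zero fun a _ => by rw [Matrix.blockDiagonal'_apply_ne _ _ _ hk, mul_zero]
  · simp

/-- (Theorem 2, rank implication) If there is an invertible
block-diagonal `X = X₁ ⊕ ⋯ ⊕ X_r` with `W X Zᵀ = 0`, then the column-wise
Khatri-Rao product `Z ⋆ W = [Z₁⊗W₁ … Z_r⊗W_r]` has rank strictly less than
`t₁² + ⋯ + t_r²`. -/
theorem khatri_rao_rank_deficient_of_symmetrizable
    (r : ℕ) (hr : 0 < r) (t : Fin r → ℕ) (ht : ∀ j, 0 < t j) (n m : ℕ)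
    (W : Matrix (Fin n) ((j : Fin r) × Fin (t j)) ℝ)
    (Z : Matrix (Fin m) ((j : Fin r) × Fin (t j)) ℝ)
    (Xb : (j : Fin r) → Matrix (Fin (t j)) (Fin (t j)) ℝ)
    (hX : IsUnit (Matrix.blockDiagonal' Xb))
    (hWXZ : W * Matrix.blockDiagonal' Xb * Zᵀ = 0) :
    (Matrix.of (fun (p : Fin m × Fin n) (c : (j : Fin r) × (Fin (t j) × Fin (t j))) =>
        Z p.1 ⟨c.1, c.2.1⟩ * W p.2 ⟨c.1, c.2.2⟩)).rank <
      ∑ j : Fin r, (t j) ^ 2 := by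
  have hcard : Fintype.card ((j : Fin r) × (Fin (t j) × Fin (t j))) = ∑ j, t j ^ 2 := by
    simp [sq]
  rw [← hcard]
  refine Matrix.rank_lt_card_of_mulVec_eq_zero _ (v := fun c => Xb c.1 c.2.2 c.2.1) ?_ ?_
  · intro hv
    have hXb : Xb = 0 := by
      ext j a b
      exact congrFun hv ⟨j, b, a⟩
    have : Nonempty ((j : Fin r) × Fin (t j)) := ⟨⟨⟨0, hr⟩, ⟨0, ht _⟩⟩⟩
    rw [hXb, Matrix.blockDiagonal'_zero] at hX
    exact not_isUnit_zero hX
  · ext ⟨i, k⟩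
    have h := congrFun (congrFun hWXZ k) i
    rw [Matrix.mul_apply, Fintype.sum_sigma] at h
    simp only [Matrix.mul_blockDiagonal'_apply, Matrix.transpose_apply, Finset.sum_mul] at h
    simp only [Matrix.mulVec, dotProduct, Matrix.of_apply, Fintype.sum_sigma,
      Fintype.sum_prod_type]
    refine Eq.trans ?_ h
    refine Finset.sum_congr rfl fun j _ => Finset.sum_congr rfl fun b _ =>
      Finset.sum_congr rfl fun a _ => ?_
    ring
end

section
/- Let T₁, T₂, T₃, T₄ be positive reals and c₁₁, c₁₂, c₂₁, c₂₂ reals with c₁₂ ≠ 0 and c₂₁ ≠ 0. Let G be the 2×2 matrix over the field of real rational functions ℝ(s) with entries G₁₁ = c₁₁/(1+sT₁), G₁₂ = c₁₂/((1+sT₁)(1+sT₃)), G₂₁ = c₂₁/((1+sT₂)(1+sT₄)), G₂₂ = c₂₂/(1+sT₂). Then there exists a 2×2 real signature matrix Σ_e with Σ_e Gᵀ = G Σ_e if and only if both of the following hold: (T₁ = T₂ and T₃ = T₄) or (T₁ = T₄ and T₂ = T₃); and c₁₂ = c₂₁ or c₁₂ = −c₂₁. -/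
open Matrix

theorem one_add_X_mul_C_ne_zero {K : Type*} [Field K] (T : K) :
    (1 + RatFunc.X * RatFunc.C T : RatFunc K) ≠ 0 := by
  have hp : (1 + Polynomial.X * Polynomial.C T : Polynomial K) ≠ 0 := fun h => by
    simpa using congrArg (Polynomial.eval 0) h
  simpa [-Polynomial.X_mul_C] using RatFunc.algebraMap_ne_zero hp

/-- Two products of first-order lags that agree have the same gain, and time constants
with the same elementary symmetric functions. -/
theorem C_div_lag_mul_lag_eq {a b T₁ T₂ T₃ T₄ : ℝ} (ha : a ≠ 0)
    (h : RatFunc.C a / ((1 + RatFunc.X * RatFunc.C T₁) * (1 + RatFunc.X * RatFunc.C T₃)) =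
      RatFunc.C b / ((1 + RatFunc.X * RatFunc.C T₂) * (1 + RatFunc.X * RatFunc.C T₄))) :
    a = b ∧ T₁ + T₃ = T₂ + T₄ ∧ T₁ * T₃ = T₂ * T₄ := by
  rw [div_eq_div_iff (mul_ne_zero (one_add_X_mul_C_ne_zero _) (one_add_X_mul_C_ne_zero _))
    (mul_ne_zero (one_add_X_mul_C_ne_zero _) (one_add_X_mul_C_ne_zero _))] at h
  have hp : (Polynomial.C a * ((1 + Polynomial.X * Polynomial.C T₂) *
        (1 + Polynomial.X * Polynomial.C T₄)) : Polynomial ℝ) =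
      Polynomial.C b * ((1 + Polynomial.X * Polynomial.C T₁) *
        (1 + Polynomial.X * Polynomial.C T₃)) := by
    apply RatFunc.algebraMap_injective ℝ
    simpa [-Polynomial.X_mul_C] using h
  have h0 := congrArg (Polynomial.eval 0) hp
  have h1 := congrArg (Polynomial.eval 1) hp
  have h2 := congrArg (Polynomial.eval (-1)) hp
  simp only [Polynomial.eval_mul, Polynomial.eval_add, Polynomial.eval_C, Polynomial.eval_X,
    Polynomial.eval_one] at h0 h1 h2
  obtain rfl : a = b := by linarith
  have h1' := mul_left_cancel₀ ha h1
  have h2' := mul_left_cancel₀ ha h2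
  exact ⟨rfl, by linarith, by linarith⟩

/-- A pair of numbers is determined, up to order, by its sum and its product. -/
theorem eq_and_eq_or_of_add_eq_of_mul_eq {a b c d : ℝ} (hs : a + c = b + d)
    (hp : a * c = b * d) : (a = b ∧ c = d) ∨ (a = d ∧ b = c) := by
  have h : (a - b) * (a - d) = 0 := by linear_combination a * hs - hp
  rcases mul_eq_zero.mp h with h | h
  · exact Or.inl ⟨by linarith, by linarith⟩
  · exact Or.inr ⟨by linarith, by linarith⟩

/-- The quadruple-tank transfer function `G` is symmetric
(`Σₑ Gᵀ = G Σₑ` for some signature matrix `Σₑ`) iff the time constants pair up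
(`T₁ = T₂ ∧ T₃ = T₄` or `T₁ = T₄ ∧ T₂ = T₃`) and `c₁₂ = ±c₂₁`. -/
theorem quadruple_tank_symmetric_iff
    (T₁ T₂ T₃ T₄ : ℝ) (hT₁ : 0 < T₁) (hT₂ : 0 < T₂) (hT₃ : 0 < T₃) (hT₄ : 0 < T₄)
    (c₁₁ c₁₂ c₂₁ c₂₂ : ℝ) (h₁₂ : c₁₂ ≠ 0) (h₂₁ : c₂₁ ≠ 0) :
    (let s : RatFunc ℝ := RatFunc.X
     let G : Matrix (Fin 2) (Fin 2) (RatFunc ℝ) :=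
       !![RatFunc.C c₁₁ / (1 + s * RatFunc.C T₁),
          RatFunc.C c₁₂ / ((1 + s * RatFunc.C T₁) * (1 + s * RatFunc.C T₃));
          RatFunc.C c₂₁ / ((1 + s * RatFunc.C T₂) * (1 + s * RatFunc.C T₄)),
          RatFunc.C c₂₂ / (1 + s * RatFunc.C T₂)]
     ∃ σ : Fin 2 → ℝ, (∀ i, σ i = 1 ∨ σ i = -1) ∧
       Matrix.diagonal (fun i => RatFunc.C (σ i)) * Gᵀ =
         G * Matrix.diagonal (fun i => RatFunc.C (σ i))) ↔
    (((T₁ = T₂ ∧ T₃ = T₄) ∨ (T₁ = T₄ ∧ T₂ = T₃)) ∧ (c₁₂ = c₂₁ ∨ c₁₂ = -c₂₁)) := by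
  extract_lets s G
  constructor
  · rintro ⟨σ, hσ, h⟩
    have h01 := congrFun (congrFun h 0) 1
    simp only [Matrix.diagonal_mul, Matrix.mul_diagonal, Matrix.transpose_apply] at h01
    have key : RatFunc.C (c₁₂ * σ 1) / ((1 + s * RatFunc.C T₁) * (1 + s * RatFunc.C T₃)) =
        RatFunc.C (σ 0 * c₂₁) / ((1 + s * RatFunc.C T₂) * (1 + s * RatFunc.C T₄)) := by
      rw [map_mul, map_mul, mul_div_right_comm, mul_div_assoc]
      exact h01.symm
    have hne : σ 1 ≠ 0 := by rcases hσ 1 with h | h <;> simp [h]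
    obtain ⟨hc, hs, hp⟩ := C_div_lag_mul_lag_eq (mul_ne_zero h₁₂ hne) key
    refine ⟨eq_and_eq_or_of_add_eq_of_mul_eq hs hp, ?_⟩
    rcases hσ 0 with h0 | h0 <;> rcases hσ 1 with h1 | h1 <;> rw [h0, h1] at hc
    · left; linarith
    · right; linarith
    · right; linarith
    · left; linarith
  · rintro ⟨hT, hc⟩
    have hden : (1 + s * RatFunc.C T₁) * (1 + s * RatFunc.C T₃) =
        (1 + s * RatFunc.C T₂) * (1 + s * RatFunc.C T₄) := by
      rcases hT with ⟨rfl, rfl⟩ | ⟨rfl, rfl⟩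
      · rfl
      · ring
    obtain ⟨ε, hε, hcε⟩ : ∃ ε : ℝ, (ε = 1 ∨ ε = -1) ∧ c₂₁ = c₁₂ * ε := by
      rcases hc with h | h
      · exact ⟨1, Or.inl rfl, by linarith⟩
      · exact ⟨-1, Or.inr rfl, by linarith⟩
    refine ⟨![1, ε], by simpa [Fin.forall_fin_two] using hε, ?_⟩
    have hoff : G 1 0 = G 0 1 * RatFunc.C ε := by
      simp [G, hden, hcε, mul_div_right_comm]
    ext i j
    rw [Matrix.diagonal_mul, Matrix.mul_diagonal, Matrix.transpose_apply]
    fin_cases i <;> fin_cases j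
    · exact mul_comm _ _
    · simpa using hoff
    · simpa [mul_comm] using hoff.symm
    · exact mul_comm _ _
end

section
/- Let T₁, T₂, T₃, T₄ be positive reals and c₁₁, c₁₂, c₂₁, c₂₂ reals with c₁₂ ≠ 0 and c₂₁ ≠ 0, and assume (T₁ = T₂ and T₃ = T₄) or (T₁ = T₄ and T₂ = T₃). Let G be the 2×2 matrix over the field of real rational functions ℝ(s) with entries G₁₁ = c₁₁/(1+sT₁), G₁₂ = c₁₂/((1+sT₁)(1+sT₃)), G₂₁ = c₂₁/((1+sT₂)(1+sT₄)), G₂₂ = c₂₂/(1+sT₂). Then G is symmetrizable: there exist an invertible real 2×2 matrix K and a 2×2 real signature matrix Σ_e such that H := K⁻¹ G K satisfies Σ_e Hᵀ = H Σ_e. -/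
open Matrix

/-- A nonzero real multiple is, up to sign, multiplication by the square of a nonzero real. -/
theorem exists_sq_mul_sign_eq {a b : ℝ} (ha : a ≠ 0) (hb : b ≠ 0) :
    ∃ k ε : ℝ, k ≠ 0 ∧ (ε = 1 ∨ ε = -1) ∧ b = a * k ^ 2 * ε := by
  have hr : b / a ≠ 0 := div_ne_zero hb ha
  have hk : √|b / a| ^ 2 = |b / a| := Real.sq_sqrt (abs_nonneg _)
  have hk0 : √|b / a| ≠ 0 := (Real.sqrt_pos.mpr (abs_pos.mpr hr)).ne'
  rcases abs_choice (b / a) with h | h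
  · refine ⟨√|b / a|, 1, hk0, Or.inl rfl, ?_⟩
    rw [hk, h]
    field_simp
  · refine ⟨√|b / a|, -1, hk0, Or.inr rfl, ?_⟩
    rw [hk, h]
    field_simp

/-- A `2 × 2` matrix whose off-diagonal entries are `a * d` and `a * k ^ 2 * ε * d` becomes
symmetric with respect to `diag(1, ε)` after rescaling by `diag(1, k)`. -/
theorem signature_symmetric_of_rescale {F : Type*} [Field F] {k ε : F} (hk : k ≠ 0)
    (a d p q : F) :
    diagonal ![1, ε] * ((diagonal ![1, k])⁻¹ * !![p, a * d; a * k ^ 2 * ε * d, q] *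
        diagonal ![1, k])ᵀ =
      ((diagonal ![1, k])⁻¹ * !![p, a * d; a * k ^ 2 * ε * d, q] * diagonal ![1, k]) *
        diagonal ![1, ε] := by
  have hinv : (diagonal ![1, k])⁻¹ = diagonal ![1, k⁻¹] := by
    refine inv_eq_left_inv ?_
    rw [diagonal_mul_diagonal, ← diagonal_one]
    congr 1
    ext i
    fin_cases i <;> simp [hk]
  rw [hinv]
  ext i j
  fin_cases i <;> fin_cases j <;> simp [mul_diagonal, diagonal_mul] <;> field_simp

/-- Under the time-constant pairing condition
(`T₁ = T₂ ∧ T₃ = T₄` or `T₁ = T₄ ∧ T₂ = T₃`), the quadruple-tank transfer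
function `G` is symmetrizable: for some constant invertible real `K` and some
signature matrix `Σₑ`, the transformed system `H := K⁻¹ G K` satisfies
`Σₑ Hᵀ = H Σₑ`. -/
theorem quadruple_tank_symmetrizable
    (T₁ T₂ T₃ T₄ : ℝ) (hT₁ : 0 < T₁) (hT₂ : 0 < T₂) (hT₃ : 0 < T₃) (hT₄ : 0 < T₄)
    (c₁₁ c₁₂ c₂₁ c₂₂ : ℝ) (h₁₂ : c₁₂ ≠ 0) (h₂₁ : c₂₁ ≠ 0)
    (hT : (T₁ = T₂ ∧ T₃ = T₄) ∨ (T₁ = T₄ ∧ T₂ = T₃)) :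
    let s : RatFunc ℝ := RatFunc.X
    let G : Matrix (Fin 2) (Fin 2) (RatFunc ℝ) :=
      !![RatFunc.C c₁₁ / (1 + s * RatFunc.C T₁),
         RatFunc.C c₁₂ / ((1 + s * RatFunc.C T₁) * (1 + s * RatFunc.C T₃));
         RatFunc.C c₂₁ / ((1 + s * RatFunc.C T₂) * (1 + s * RatFunc.C T₄)),
         RatFunc.C c₂₂ / (1 + s * RatFunc.C T₂)]
    ∃ (K : Matrix (Fin 2) (Fin 2) ℝ) (σ : Fin 2 → ℝ),
      IsUnit K ∧ (∀ i, σ i = 1 ∨ σ i = -1) ∧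
      Matrix.diagonal (fun i => RatFunc.C (σ i)) *
          ((K.map RatFunc.C)⁻¹ * G * K.map RatFunc.C)ᵀ =
        ((K.map RatFunc.C)⁻¹ * G * K.map RatFunc.C) *
          Matrix.diagonal (fun i => RatFunc.C (σ i)) := by
  intro s G
  obtain ⟨k, ε, hk, hε, rfl⟩ := exists_sq_mul_sign_eq h₁₂ h₂₁
  have hD : (1 + s * RatFunc.C T₂) * (1 + s * RatFunc.C T₄) =
      (1 + s * RatFunc.C T₁) * (1 + s * RatFunc.C T₃) := by
    rcases hT with ⟨rfl, rfl⟩ | ⟨rfl, rfl⟩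
    · rfl
    · exact mul_comm _ _
  refine ⟨diagonal ![1, k], ![1, ε], ?_, ?_, ?_⟩
  · rw [isUnit_iff_isUnit_det]
    simp [hk]
  · intro i
    fin_cases i
    · exact Or.inl rfl
    · exact hε
  · have hσ : (fun i => RatFunc.C (![1, ε] i)) = ![1, RatFunc.C ε] := by
      ext i
      fin_cases i <;> simp
    have hK : (diagonal ![1, k]).map RatFunc.C = diagonal ![1, RatFunc.C k] := by
      rw [diagonal_map (map_zero _)]
      congr 1
      ext i
      fin_cases i <;> simp
    have hk' : RatFunc.C k ≠ 0 := (map_ne_zero _).mpr hk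
    have h := signature_symmetric_of_rescale (ε := RatFunc.C ε) hk' (RatFunc.C c₁₂)
      ((1 + s * RatFunc.C T₁) * (1 + s * RatFunc.C T₃))⁻¹
      (RatFunc.C c₁₁ / (1 + s * RatFunc.C T₁)) (RatFunc.C c₂₂ / (1 + s * RatFunc.C T₂))
    rw [hσ, hK]
    simpa only [G, hD, map_mul, map_pow, div_eq_mul_inv] using h
end
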